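/- arXiv:1802.09340 — 2 statements merged into one kernel-verified Lean document; each statement's English description precedes it below -/
import Mathlib

section
/- There exists a magic knight's tour of the 4×24 board: a knight's tour in which each of the four 24-cell rows sums to 1164 and each of the twenty-four 4-cell columns sums to 194. -/
/-- Two cells are a knight's move apart: coordinate differences in absolute
value are {1,2}. -/
def knightMove {m n : ℕ} (a b : Fin m × Fin n) : Prop :=
  (((a.1.val : ℤ) - b.1.val).natAbs = 1 ∧ ((a.2.val : ℤ) - b.2.val).natAbs = 2) ∨
  (((a.1.val : ℤ) - b.1.val).natAbs = 2 ∧ ((a.2.val : ℤ) - b.2.val).natAbs = 1)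

/-- A knight's tour of the m×n board: a bijective numbering (as an equiv from
`Fin (m*n)`, representing the numbers 1,…,m·n) of the cells, such that
consecutive numbers occupy cells a knight's move apart. -/
def IsKnightTour (m n : ℕ) (t : Fin (m * n) ≃ Fin m × Fin n) : Prop :=
  ∀ (k : ℕ) (h : k + 1 < m * n),
    knightMove (t ⟨k, Nat.lt_of_succ_lt h⟩) (t ⟨k + 1, h⟩)

/-- The number (in 1,…,m·n) assigned to a cell by the tour. -/
def cellNum {m n : ℕ} (t : Fin (m * n) ≃ Fin m × Fin n) (c : Fin m × Fin n) : ℕ :=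
  (t.symm c).val + 1

/-- The sum of the numbers in row `i` (an n-cell line). -/
def rowSum {m n : ℕ} (t : Fin (m * n) ≃ Fin m × Fin n) (i : Fin m) : ℕ :=
  ∑ j : Fin n, cellNum t (i, j)

/-- The sum of the numbers in column `j` (an m-cell line). -/
def colSum {m n : ℕ} (t : Fin (m * n) ≃ Fin m × Fin n) (j : Fin n) : ℕ :=
  ∑ i : Fin m, cellNum t (i, j)

/-- The cells of a magic knight's tour of the 4×24 board, in the order in which they are visited. -/
def magicTourCells : List (Fin 4 × Fin 24) :=
  [(0, 2), (1, 0), (3, 1), (2, 3), (3, 5), (1, 4), (0, 6), (2, 7),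
    (3, 9), (1, 10), (0, 8), (2, 9), (3, 11), (1, 12), (3, 13), (1, 14),
    (0, 16), (2, 17), (3, 15), (1, 16), (0, 18), (1, 20), (0, 22), (2, 23),
    (3, 21), (2, 19), (0, 20), (1, 22), (3, 23), (2, 21), (3, 19), (1, 18),
    (3, 17), (2, 15), (0, 14), (2, 13), (0, 12), (2, 11), (0, 10), (1, 8),
    (3, 7), (1, 6), (0, 4), (2, 5), (3, 3), (2, 1), (0, 0), (1, 2),
    (2, 0), (0, 1), (1, 3), (3, 2), (2, 4), (0, 5), (2, 6), (0, 7),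
    (2, 8), (3, 10), (1, 11), (3, 12), (1, 13), (3, 14), (1, 15), (0, 17),
    (2, 18), (0, 19), (1, 21), (0, 23), (2, 22), (3, 20), (1, 19), (0, 21),
    (1, 23), (3, 22), (2, 20), (3, 18), (2, 16), (0, 15), (1, 17), (3, 16),
    (2, 14), (0, 13), (2, 12), (0, 11), (1, 9), (3, 8), (2, 10), (0, 9),
    (1, 7), (3, 6), (1, 5), (3, 4), (2, 2), (0, 3), (1, 1), (3, 0)]

theorem magicTourCells_nodup : magicTourCells.Nodup := by
  decide +kernel

theorem mem_magicTourCells (c : Fin 4 × Fin 24) : c ∈ magicTourCells := by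
  revert c
  decide +kernel

/-- The numbering of the 4×24 board given by `magicTourCells`. -/
def magicTour : Fin (4 * 24) ≃ Fin 4 × Fin 24 :=
  magicTourCells_nodup.getEquivOfForallMemList magicTourCells mem_magicTourCells

instance {m n : ℕ} (a b : Fin m × Fin n) : Decidable (knightMove a b) := by
  unfold knightMove
  infer_instance

theorem isKnightTour_magicTour : IsKnightTour 4 24 magicTour := by
  have h : ∀ k : Fin 95, knightMove (magicTour k.castSucc) (magicTour k.succ) := by
    decide +kernel
  exact fun k hk => h ⟨k, Nat.lt_of_succ_lt_succ hk⟩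

theorem rowSum_magicTour : ∀ i : Fin 4, rowSum magicTour i = 1164 := by
  decide +kernel

theorem colSum_magicTour : ∀ j : Fin 24, colSum magicTour j = 194 := by
  decide +kernel

/-- There exists a magic knight's tour of the 4×24 board. -/
theorem magic_tour_4x24 :
    ∃ t : Fin (4 * 24) ≃ Fin 4 × Fin 24, IsKnightTour 4 24 t ∧
      (∀ i : Fin 4, rowSum t i = 1164) ∧ (∀ j : Fin 24, colSum t j = 194) :=
  ⟨magicTour, isKnightTour_magicTour, rowSum_magicTour, colSum_magicTour⟩
end

section
/- There exists a quasi-magic knight's tour of the 6×8 board with the 6-cell lines magic: a knight's tour in which each of the eight 6-cell lines sums to the magic constant 147, and the six 8-cell lines take exactly two distinct sum values. -/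
/-- The cells of the 6×8 board, in the order in which the tour visits them. -/
def tourCell : Fin (6 * 8) → Fin 6 × Fin 8 :=
  ![(0, 0), (1, 2), (2, 4), (0, 5), (1, 7), (3, 6), (5, 7), (4, 5),
    (3, 3), (5, 2), (4, 0), (2, 1), (1, 3), (0, 1), (2, 0), (4, 1),
    (5, 3), (3, 2), (4, 4), (5, 6), (3, 7), (1, 6), (0, 4), (2, 5),
    (0, 6), (1, 4), (0, 2), (2, 3), (1, 1), (3, 0), (5, 1), (4, 3),
    (3, 5), (5, 4), (4, 6), (2, 7), (1, 5), (0, 7), (2, 6), (4, 7),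
    (5, 5), (3, 4), (4, 2), (5, 0), (3, 1), (1, 0), (2, 2), (0, 3)]

/-- The (zero-based) step at which the tour visits each cell of the 6×8 board. -/
def tourStep : Matrix (Fin 6) (Fin 8) (Fin (6 * 8)) :=
  !![0, 13, 26, 47, 22, 3, 24, 37;
     45, 28, 1, 12, 25, 36, 21, 4;
     14, 11, 46, 27, 2, 23, 38, 35;
     29, 44, 17, 8, 41, 32, 5, 20;
     10, 15, 42, 31, 18, 7, 34, 39;
     43, 30, 9, 16, 33, 40, 19, 6]

/-- The tour as a bijective numbering of the cells. -/
def tour : Fin (6 * 8) ≃ Fin 6 × Fin 8 where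
  toFun := tourCell
  invFun c := tourStep c.1 c.2
  left_inv := by unfold Function.LeftInverse; decide +kernel
  right_inv := by unfold Function.RightInverse Function.LeftInverse; decide +kernel

instance inst_s13 {m n : ℕ} (a b : Fin m × Fin n) : Decidable (knightMove a b) := by
  unfold knightMove; infer_instance

theorem isKnightTour_tour : IsKnightTour 6 8 tour := by
  have step : ∀ k : Fin 47, knightMove (tour ⟨k, by omega⟩) (tour ⟨k + 1, by omega⟩) := by
    decide +kernel
  exact fun k h => step ⟨k, by omega⟩

theorem colSum_tour : ∀ j : Fin 8, colSum tour j = 147 := by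
  decide +kernel

theorem rowSum_tour : ∀ i : Fin 6, rowSum tour i = if i < 2 then 180 else 204 := by
  decide +kernel

/-- There exists a quasi-magic knight's tour of the 6×8 board: every
6-cell line (column) sums to the magic constant 147, and the 8-cell lines
(rows) take exactly two distinct sum values. -/
theorem quasi_magic_6x8_cols :
    ∃ t : Fin (6 * 8) ≃ Fin 6 × Fin 8, IsKnightTour 6 8 t ∧
      (∀ j : Fin 8, colSum t j = 147) ∧
      ∃ a b : ℕ, a ≠ b ∧ (∀ i : Fin 6, rowSum t i = a ∨ rowSum t i = b) ∧
        (∃ i : Fin 6, rowSum t i = a) ∧ (∃ i : Fin 6, rowSum t i = b) := by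
  refine ⟨tour, isKnightTour_tour, colSum_tour, 180, 204, by decide, fun i => ?_,
    ⟨0, rowSum_tour 0⟩, ⟨2, rowSum_tour 2⟩⟩
  rw [rowSum_tour]
  split_ifs <;> simp
end
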